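/- Let (X,w) be a Euclidean 6-design in ℝ^22 supported by exactly two concentric spheres of positive radii r1, r2 centered at the origin, with fibers X1 and X2, |X| = 2300 and |X1| = 275 (so |X2| = 2025). Then for every x ∈ X2, the number of y ∈ X2 with x·y = 7r2²/22 equals 462, the number with x·y = −r2²/44 equals 1232, and the number with x·y = −4r2²/11 equals 330. -/

import Mathlib

open MeasureTheory Metric MvPolynomial
open scoped RealInnerProductSpace Classical

/-- Average of a polynomial over the sphere of radius `r` centered at the origin in `ℝⁿ`,
with respect to the (rotation-invariant, normalized) surface measure. -/
noncomputable def sphereAvg (n : ℕ) (r : ℝ) (f : MvPolynomial (Fin n) ℝ) : ℝ :=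
  ⨍ u : sphere (0 : EuclideanSpace ℝ (Fin n)) 1,
    eval (fun i => r * (u : EuclideanSpace ℝ (Fin n)) i) f
    ∂((volume : Measure (EuclideanSpace ℝ (Fin n))).toSphere)

/-- `(X₁ ∪ X₂, w)` is a Euclidean `t`-design of `ℝ²²` supported by the two concentric spheres
of radii `r₁` and `r₂` centered at the origin, with fibers `X₁ ⊆ S(0,r₁)` and `X₂ ⊆ S(0,r₂)`. -/
def IsEuclideanDesignTwoSpheres (t : ℕ) (X₁ X₂ : Finset (EuclideanSpace ℝ (Fin 22)))
    (w : EuclideanSpace ℝ (Fin 22) → ℝ) (r₁ r₂ : ℝ) : Prop :=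
  ∀ f : MvPolynomial (Fin 22) ℝ, f.totalDegree ≤ t →
    (∑ x ∈ X₁, w x) * sphereAvg 22 r₁ f + (∑ x ∈ X₂, w x) * sphereAvg 22 r₂ f
      = ∑ x ∈ X₁ ∪ X₂, w x * eval (x : Fin 22 → ℝ) f

section SphereAverage

open scoped Pointwise

variable {E : Type*} [NormedAddCommGroup E] [InnerProductSpace ℝ E]

theorem norm_sq_smul_add_smul {e f : E} (he : ‖e‖ = 1) (hf : ‖f‖ = 1) (hef : ⟪e, f⟫ = 0)
    (a b : ℝ) : ‖a • e + b • f‖ ^ 2 = a ^ 2 + b ^ 2 := by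
  rw [norm_add_sq_real, norm_smul, norm_smul, inner_smul_left, inner_smul_right, hef, he, hf]
  simp

/-- The self-map of the unit sphere induced by a linear isometry. -/
def sphereMap (e : E ≃ₗᵢ[ℝ] E) (u : sphere (0 : E) 1) : sphere (0 : E) 1 :=
  ⟨e u, by simp⟩

theorem continuous_sphereMap (e : E ≃ₗᵢ[ℝ] E) : Continuous (sphereMap e) :=
  (e.continuous.comp continuous_subtype_val).subtype_mk _

variable [FiniteDimensional ℝ E] [MeasurableSpace E] [BorelSpace E]

theorem map_sphereMap_toSphere (e : E ≃ₗᵢ[ℝ] E) :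
    ((volume : Measure E).toSphere).map (sphereMap e) = (volume : Measure E).toSphere := by
  have hm : Measurable (sphereMap e) := (continuous_sphereMap e).measurable
  ext s hs
  rw [Measure.map_apply hm hs, Measure.toSphere_apply' _ (hm hs), Measure.toSphere_apply' _ hs]
  have hset : Set.Ioo (0 : ℝ) 1 • ((↑) '' (sphereMap e ⁻¹' s) : Set E)
      = e ⁻¹' (Set.Ioo (0 : ℝ) 1 • ((↑) '' s : Set E)) := by
    ext x
    simp only [Set.mem_smul, Set.mem_image, Set.mem_preimage]
    constructor
    · rintro ⟨r, hr, _, ⟨u, hu, rfl⟩, rfl⟩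
      exact ⟨r, hr, _, ⟨_, hu, rfl⟩, by simp [sphereMap]⟩
    · rintro ⟨r, hr, _, ⟨u, hu, rfl⟩, h⟩
      refine ⟨r, hr, _, ⟨sphereMap e.symm u, ?_, rfl⟩, ?_⟩
      · simpa [sphereMap] using hu
      · apply e.injective
        simp [sphereMap, h]
  have hp := e.measurePreserving
  have := hp.measure_preimage_equiv (f := e.toHomeomorph.toMeasurableEquiv)
    (Set.Ioo (0 : ℝ) 1 • ((↑) '' s : Set E))
  rw [hset]
  congr 1

/-- The average of a function over the unit sphere. -/
noncomputable def unitSphereAvg (f : E → ℝ) : ℝ :=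
  ⨍ u : sphere (0 : E) 1, f u ∂(volume : Measure E).toSphere

theorem integrable_toSphere {f : E → ℝ} (hf : Continuous f) :
    Integrable (fun u : sphere (0 : E) 1 => f u) (volume : Measure E).toSphere := by
  have : CompactSpace (sphere (0 : E) 1) := isCompact_iff_compactSpace.mp (isCompact_sphere _ _)
  exact (hf.comp continuous_subtype_val).integrable_of_hasCompactSupport
    (HasCompactSupport.of_compactSpace _)

theorem unitSphereAvg_add {f g : E → ℝ} (hf : Continuous f) (hg : Continuous g) :
    unitSphereAvg (fun u => f u + g u) = unitSphereAvg f + unitSphereAvg g := by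
  simp only [unitSphereAvg, average_eq]
  rw [integral_add (integrable_toSphere hf) (integrable_toSphere hg), smul_add]

theorem unitSphereAvg_const_mul (a : ℝ) (f : E → ℝ) :
    unitSphereAvg (fun u => a * f u) = a * unitSphereAvg f := by
  simp only [unitSphereAvg, average_eq, integral_const_mul, smul_eq_mul]
  ring

theorem unitSphereAvg_sum {ι : Type*} (s : Finset ι) {f : ι → E → ℝ}
    (hf : ∀ i, Continuous (f i)) :
    unitSphereAvg (fun u => ∑ i ∈ s, f i u) = ∑ i ∈ s, unitSphereAvg (f i) := by
  simp only [unitSphereAvg, average_eq]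
  rw [integral_finsetSum _ fun i _ => integrable_toSphere (hf i), Finset.smul_sum]

theorem unitSphereAvg_congr {f g : E → ℝ} (h : ∀ u, ‖u‖ = 1 → f u = g u) :
    unitSphereAvg f = unitSphereAvg g := by
  unfold unitSphereAvg
  congr 1
  ext u
  exact h u (by simp)

theorem unitSphereAvg_one [Nontrivial E] : unitSphereAvg (fun _ : E => (1 : ℝ)) = 1 := by
  have : NeZero ((volume : Measure E).toSphere) := ⟨Measure.toSphere_ne_zero _⟩
  simp [unitSphereAvg]

theorem unitSphereAvg_comp (e : E ≃ₗᵢ[ℝ] E) {f : E → ℝ} (hf : Continuous f) :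
    unitSphereAvg (fun u => f (e u)) = unitSphereAvg f := by
  simp only [unitSphereAvg, average_eq]
  congr 1
  conv_rhs => rw [← map_sphereMap_toSphere e]
  exact (integral_map (continuous_sphereMap e).aemeasurable
    (hf.comp continuous_subtype_val).aestronglyMeasurable).symm

theorem unitSphereAvg_inner_pow_eq (k : ℕ) {x y : E} (h : ‖x‖ = ‖y‖) :
    unitSphereAvg (fun u => ⟪x, u⟫ ^ k) = unitSphereAvg (fun u => ⟪y, u⟫ ^ k) := by
  set e := (ℝ ∙ (x - y))ᗮ.reflection
  have hxy : e x = y := Submodule.reflection_sub h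
  rw [← unitSphereAvg_comp e (f := fun u => ⟪y, u⟫ ^ k) (by fun_prop)]
  congr 1
  ext u
  rw [← hxy, e.inner_map_map]

theorem unitSphereAvg_inner_pow_odd {k : ℕ} (hk : Odd k) (x : E) :
    unitSphereAvg (fun u => ⟪x, u⟫ ^ k) = 0 := by
  have h := unitSphereAvg_inner_pow_eq k (norm_neg x)
  simp only [inner_neg_left, hk.neg_pow, neg_eq_neg_one_mul (_ ^ k),
    unitSphereAvg_const_mul] at h
  linarith

theorem unitSphereAvg_inner_pow_norm (k : ℕ) {x e : E} (he : ‖e‖ = 1) :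
    unitSphereAvg (fun u => ⟪x, u⟫ ^ k) = ‖x‖ ^ k * unitSphereAvg (fun u => ⟪e, u⟫ ^ k) := by
  rw [unitSphereAvg_inner_pow_eq k (y := ‖x‖ • e) (by simp [norm_smul, he]),
    ← unitSphereAvg_const_mul]
  simp [inner_smul_left, mul_pow]

theorem unitSphereAvg_sum_inner_pow {ι : Type*} (s : Finset ι) (c : ι → ℝ) (x : ι → E) (k : ℕ)
    {e : E} (he : ‖e‖ = 1) :
    unitSphereAvg (fun u => ∑ i ∈ s, c i * ⟪x i, u⟫ ^ k)
      = (∑ i ∈ s, c i * ‖x i‖ ^ k) * unitSphereAvg (fun u => ⟪e, u⟫ ^ k) := by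
  rw [unitSphereAvg_sum s (fun i => by fun_prop), Finset.sum_mul]
  refine Finset.sum_congr rfl fun i _ => ?_
  rw [unitSphereAvg_const_mul, unitSphereAvg_inner_pow_norm k he, mul_assoc]

theorem unitSphereAvg_inner_sq_mul_inner_sq {e f : E} (he : ‖e‖ = 1) (hf : ‖f‖ = 1)
    (hef : ⟪e, f⟫ = 0) :
    3 * unitSphereAvg (fun u => ⟪e, u⟫ ^ 2 * ⟪f, u⟫ ^ 2)
      = unitSphereAvg (fun u => ⟪e, u⟫ ^ 4) := by
  have h := unitSphereAvg_sum_inner_pow Finset.univ (![1 / 12, 1 / 12, -1 / 6, -1 / 6] : Fin 4 → ℝ)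
    ![(1 : ℝ) • e + (1 : ℝ) • f, (1 : ℝ) • e + (-1 : ℝ) • f, e, f] 4 he
  have hn := fun a b => norm_sq_smul_add_smul he hf hef a b
  have hn4 : ∀ a b : ℝ, ‖a • e + b • f‖ ^ 4 = (a ^ 2 + b ^ 2) ^ 2 := fun a b => by
    rw [← hn a b]; ring
  simp only [Fin.sum_univ_four, Matrix.cons_val, hn4, he, hf, inner_add_left, inner_smul_left] at h
  norm_num at h
  rw [show (fun u => ⟪e, u⟫ ^ 2 * ⟪f, u⟫ ^ 2) = _ from ?_, h]
  · ring
  · ext u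
    ring

theorem unitSphereAvg_inner_pow_four_mul_inner_sq {e f : E} (he : ‖e‖ = 1) (hf : ‖f‖ = 1)
    (hef : ⟪e, f⟫ = 0) :
    5 * unitSphereAvg (fun u => ⟪e, u⟫ ^ 4 * ⟪f, u⟫ ^ 2)
      = unitSphereAvg (fun u => ⟪e, u⟫ ^ 6) := by
  have h := unitSphereAvg_sum_inner_pow Finset.univ
    (![1 / 360, 1 / 360, -1 / 90, -1 / 90, -1 / 3, 1 / 60] : Fin 6 → ℝ)
    ![(2 : ℝ) • e + (1 : ℝ) • f, (2 : ℝ) • e + (-1 : ℝ) • f, (1 : ℝ) • e + (1 : ℝ) • f,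
      (1 : ℝ) • e + (-1 : ℝ) • f, e, f] 6 he
  have hn := fun a b => norm_sq_smul_add_smul he hf hef a b
  have hn6 : ∀ a b : ℝ, ‖a • e + b • f‖ ^ 6 = (a ^ 2 + b ^ 2) ^ 3 := fun a b => by
    rw [← hn a b]; ring
  simp only [Fin.sum_univ_six, Matrix.cons_val, hn6, he, hf, inner_add_left, inner_smul_left] at h
  norm_num at h
  rw [show (fun u => ⟪e, u⟫ ^ 4 * ⟪f, u⟫ ^ 2) = _ from ?_, h]
  · ring
  · ext u
    ring

/-- Multiplying by `1 = ∑ ⟪b j, u⟫²` and isolating the summand of `b i`. -/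
theorem unitSphereAvg_inner_pow_eq_of_basis {ι : Type*} [Fintype ι] (b : OrthonormalBasis ι ℝ E)
    (i : ι) (k : ℕ) {T : ℝ}
    (hT : ∀ j ≠ i, unitSphereAvg (fun u => ⟪b i, u⟫ ^ k * ⟪b j, u⟫ ^ 2) = T) :
    unitSphereAvg (fun u => ⟪b i, u⟫ ^ k)
      = unitSphereAvg (fun u => ⟪b i, u⟫ ^ (k + 2)) + (Fintype.card ι - 1 : ℝ) * T := by
  have h1 : unitSphereAvg (fun u => ⟪b i, u⟫ ^ k)
      = unitSphereAvg (fun u => ∑ j, ⟪b i, u⟫ ^ k * ⟪b j, u⟫ ^ 2) := by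
    refine unitSphereAvg_congr fun u hu => ?_
    rw [← Finset.mul_sum, b.sum_sq_inner_right, hu]
    simp
  rw [h1, unitSphereAvg_sum _ (fun j => by fun_prop), ← Finset.add_sum_erase _ _ (Finset.mem_univ i),
    Finset.sum_congr rfl fun j hj => hT j (Finset.ne_of_mem_erase hj)]
  congr 1
  · simp only [← pow_add]
  · have : 1 ≤ Fintype.card ι := Fintype.card_pos_iff.mpr ⟨i⟩
    simp [Finset.card_erase_of_mem, Nat.cast_sub this]

theorem unitSphereAvg_inner_sq {ι : Type*} [Fintype ι] (b : OrthonormalBasis ι ℝ E) (i : ι) :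
    Fintype.card ι * unitSphereAvg (fun u => ⟪b i, u⟫ ^ 2) = 1 := by
  have : Nontrivial E := ⟨b i, 0, b.orthonormal.ne_zero i⟩
  have h := unitSphereAvg_inner_pow_eq_of_basis b i 0
    (T := unitSphereAvg (fun u => ⟪b i, u⟫ ^ 2)) fun j _ => by
      simp only [pow_zero, one_mul]
      exact unitSphereAvg_inner_pow_eq 2 (by simp)
  simp only [pow_zero, unitSphereAvg_one, zero_add] at h
  linarith

theorem unitSphereAvg_inner_pow_four {ι : Type*} [Fintype ι] (b : OrthonormalBasis ι ℝ E) (i : ι) :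
    (Fintype.card ι + 2) * unitSphereAvg (fun u => ⟪b i, u⟫ ^ 4)
      = 3 * unitSphereAvg (fun u => ⟪b i, u⟫ ^ 2) := by
  have h := unitSphereAvg_inner_pow_eq_of_basis b i 2
    (T := unitSphereAvg (fun u => ⟪b i, u⟫ ^ 4) / 3) fun j hj => by
      rw [← unitSphereAvg_inner_sq_mul_inner_sq (b.norm_eq_one i) (b.norm_eq_one j)
        (b.inner_eq_zero hj.symm)]
      ring
  linarith

theorem unitSphereAvg_inner_pow_six {ι : Type*} [Fintype ι] (b : OrthonormalBasis ι ℝ E) (i : ι) :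
    (Fintype.card ι + 4) * unitSphereAvg (fun u => ⟪b i, u⟫ ^ 6)
      = 5 * unitSphereAvg (fun u => ⟪b i, u⟫ ^ 4) := by
  have h := unitSphereAvg_inner_pow_eq_of_basis b i 4
    (T := unitSphereAvg (fun u => ⟪b i, u⟫ ^ 6) / 5) fun j hj => by
      rw [← unitSphereAvg_inner_pow_four_mul_inner_sq (b.norm_eq_one i) (b.norm_eq_one j)
        (b.inner_eq_zero hj.symm)]
      ring
  linarith

end SphereAverage

/-- The moments up to order `6` of a coordinate on the unit sphere of `ℝ²²`. -/
noncomputable def sphereMoment : ℕ → ℝ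
  | 0 => 1
  | 2 => 1 / 22
  | 4 => 1 / 176
  | 6 => 5 / 4576
  | _ => 0

theorem unitSphereAvg_inner_pow {v : EuclideanSpace ℝ (Fin 22)} (hv : ‖v‖ = 1) {k : ℕ}
    (hk : k ≤ 6) : unitSphereAvg (fun u => ⟪v, u⟫ ^ k) = sphereMoment k := by
  let b := EuclideanSpace.basisFun (Fin 22) ℝ
  have : Nontrivial (EuclideanSpace ℝ (Fin 22)) := ⟨b 0, 0, b.orthonormal.ne_zero 0⟩
  have h2 := unitSphereAvg_inner_sq b 0
  have h4 := unitSphereAvg_inner_pow_four b 0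
  have h6 := unitSphereAvg_inner_pow_six b 0
  have hb := unitSphereAvg_inner_pow_eq k (hv.trans (b.norm_eq_one 0).symm)
  rw [Fintype.card_fin] at h2 h4 h6
  push_cast at h2 h4 h6
  interval_cases k
  · simpa [sphereMoment] using unitSphereAvg_one
  · exact unitSphereAvg_inner_pow_odd (by decide) v
  · rw [hb]; simp only [sphereMoment]; linarith
  · exact unitSphereAvg_inner_pow_odd (by decide) v
  · rw [hb]; simp only [sphereMoment]; linarith
  · exact unitSphereAvg_inner_pow_odd (by decide) v
  · rw [hb]; simp only [sphereMoment]; linarith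

/-- The polynomial `⟪v, x⟫ ^ a * ‖x‖ ^ (2 * j)`. -/
noncomputable def zonalPoly {n : ℕ} (v : EuclideanSpace ℝ (Fin n)) (a j : ℕ) :
    MvPolynomial (Fin n) ℝ :=
  (∑ i, C (v i) * X i) ^ a * (∑ i, X i ^ 2) ^ j

theorem totalDegree_zonalPoly_le {n : ℕ} (v : EuclideanSpace ℝ (Fin n)) (a j : ℕ) :
    (zonalPoly v a j).totalDegree ≤ a + 2 * j := by
  refine (totalDegree_mul _ _).trans (add_le_add ?_ ?_)
  · refine (totalDegree_pow _ _).trans ?_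
    have : (∑ i, C (v i) * X i : MvPolynomial (Fin n) ℝ).totalDegree ≤ 1 :=
      totalDegree_finsetSum_le fun i _ => (totalDegree_mul _ _).trans (by simp)
    simpa using Nat.mul_le_mul_left a this
  · refine (totalDegree_pow _ _).trans ?_
    have : (∑ i, X i ^ 2 : MvPolynomial (Fin n) ℝ).totalDegree ≤ 2 :=
      totalDegree_finsetSum_le fun i _ => (totalDegree_pow _ _).trans (by simp)
    rw [mul_comm 2 j]
    exact Nat.mul_le_mul_left j this

theorem eval_zonalPoly {n : ℕ} (v x : EuclideanSpace ℝ (Fin n)) (a j : ℕ) :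
    eval (x : Fin n → ℝ) (zonalPoly v a j) = ⟪v, x⟫ ^ a * ‖x‖ ^ (2 * j) := by
  rw [pow_mul ‖x‖, EuclideanSpace.norm_sq_eq]
  simp only [zonalPoly, map_mul, map_pow, map_sum, eval_C, eval_X, PiLp.inner_apply,
    RCLike.inner_apply, conj_trivial, Real.norm_eq_abs, sq_abs, mul_comm]

theorem sphereAvg_zonalPoly {n : ℕ} (v : EuclideanSpace ℝ (Fin n)) (r : ℝ) (a j : ℕ) :
    sphereAvg n r (zonalPoly v a j) = r ^ (a + 2 * j) * unitSphereAvg (fun u => ⟪v, u⟫ ^ a) := by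
  rw [← unitSphereAvg_const_mul]
  refine unitSphereAvg_congr (f := fun u : EuclideanSpace ℝ (Fin n) =>
    eval (fun i => r * u i) (zonalPoly v a j)) fun u hu => ?_
  have h := eval_zonalPoly v (r • u) a j
  rw [inner_smul_right, norm_smul, hu, mul_one, pow_mul, Real.norm_eq_abs, sq_abs] at h
  refine Eq.trans h ?_
  ring

section Moments

variable {X₁ X₂ : Finset (EuclideanSpace ℝ (Fin 22))} {w : EuclideanSpace ℝ (Fin 22) → ℝ}
  {r₁ r₂ : ℝ}

theorem disjoint_of_norm_eq (hrne : r₁ ≠ r₂) (hX₁ : ∀ x ∈ X₁, ‖x‖ = r₁)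
    (hX₂ : ∀ x ∈ X₂, ‖x‖ = r₂) : Disjoint X₁ X₂ :=
  Finset.disjoint_left.mpr fun x h1 h2 => hrne ((hX₁ x h1).symm.trans (hX₂ x h2))

theorem IsEuclideanDesignTwoSpheres.zonal_sum
    (hrne : r₁ ≠ r₂) (hX₁ : ∀ x ∈ X₁, ‖x‖ = r₁) (hX₂ : ∀ x ∈ X₂, ‖x‖ = r₂)
    (hd : IsEuclideanDesignTwoSpheres 6 X₁ X₂ w r₁ r₂)
    {v : EuclideanSpace ℝ (Fin 22)} (hv : ‖v‖ = 1) {a j : ℕ} (haj : a + 2 * j ≤ 6) :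
    r₁ ^ (2 * j) * ∑ y ∈ X₁, w y * ⟪v, y⟫ ^ a + r₂ ^ (2 * j) * ∑ y ∈ X₂, w y * ⟪v, y⟫ ^ a
      = ((∑ y ∈ X₁, w y) * r₁ ^ (a + 2 * j) + (∑ y ∈ X₂, w y) * r₂ ^ (a + 2 * j))
        * sphereMoment a := by
  have h := hd (zonalPoly v a j) ((totalDegree_zonalPoly_le v a j).trans haj)
  rw [Finset.sum_union (disjoint_of_norm_eq hrne hX₁ hX₂), sphereAvg_zonalPoly,
    sphereAvg_zonalPoly, unitSphereAvg_inner_pow hv (by omega)] at h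
  rw [Finset.mul_sum, Finset.mul_sum]
  calc _ = _ := ?_
    _ = _ := h.symm
    _ = _ := by ring
  congr 1
  · refine Finset.sum_congr rfl fun y hy => ?_
    rw [eval_zonalPoly, hX₁ y hy]
    ring
  · refine Finset.sum_congr rfl fun y hy => ?_
    rw [eval_zonalPoly, hX₂ y hy]
    ring

theorem IsEuclideanDesignTwoSpheres.zonal_sum_fiber (hr₁ : 0 < r₁) (hr₂ : 0 < r₂)
    (hrne : r₁ ≠ r₂) (hX₁ : ∀ x ∈ X₁, ‖x‖ = r₁) (hX₂ : ∀ x ∈ X₂, ‖x‖ = r₂)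
    (hd : IsEuclideanDesignTwoSpheres 6 X₁ X₂ w r₁ r₂)
    {v : EuclideanSpace ℝ (Fin 22)} (hv : ‖v‖ = 1) {a : ℕ} (ha : a ≤ 4) :
    (∑ y ∈ X₁, w y * ⟪v, y⟫ ^ a = (∑ y ∈ X₁, w y) * r₁ ^ a * sphereMoment a) ∧
    (∑ y ∈ X₂, w y * ⟪v, y⟫ ^ a = (∑ y ∈ X₂, w y) * r₂ ^ a * sphereMoment a) := by
  have h0 := hd.zonal_sum hrne hX₁ hX₂ hv (a := a) (j := 0) (by omega)
  have h1 := hd.zonal_sum hrne hX₁ hX₂ hv (a := a) (j := 1) (by omega)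
  simp only [mul_zero, pow_zero, one_mul, mul_one, add_zero, pow_add] at h0 h1
  have hne : r₁ ^ 2 - r₂ ^ 2 ≠ 0 := by
    rw [sub_ne_zero]
    exact fun h => hrne ((sq_eq_sq₀ hr₁.le hr₂.le).mp h)
  constructor
  · apply mul_left_cancel₀ hne
    linear_combination h1 - r₂ ^ 2 * h0
  · apply mul_left_cancel₀ hne
    linear_combination r₁ ^ 2 * h0 - h1

end Moments

/-- The moment identities satisfied by the normalized inner products `t` of a two-fiber Euclidean
`6`-design with fibers `A`, `B` of radii `r`, `s`, seen from the points of `A`. -/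
structure FiberMoments {α : Type*} (A B : Finset α) (w : α → ℝ) (t : α → α → ℝ)
    (r s : ℝ) : Prop where
  r_pos : 0 < r
  s_pos : 0 < s
  weight_pos : ∀ x ∈ A, 0 < w x
  weight_pos_other : ∀ x ∈ B, 0 < w x
  self : ∀ x ∈ A, t x x = 1
  same : ∀ x ∈ A, ∀ k ≤ 4, ∑ y ∈ A, w y * t x y ^ k = (∑ y ∈ A, w y) * sphereMoment k
  cross : ∀ x ∈ A, ∀ k ≤ 4, ∑ y ∈ B, w y * t x y ^ k = (∑ y ∈ B, w y) * sphereMoment k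
  total : ∀ x ∈ A, ∀ k ≤ 6,
    r ^ k * ∑ y ∈ A, w y * t x y ^ k + s ^ k * ∑ y ∈ B, w y * t x y ^ k
      = ((∑ y ∈ A, w y) * r ^ k + (∑ y ∈ B, w y) * s ^ k) * sphereMoment k

theorem IsEuclideanDesignTwoSpheres.symm {k : ℕ} {X₁ X₂ : Finset (EuclideanSpace ℝ (Fin 22))}
    {w : EuclideanSpace ℝ (Fin 22) → ℝ} {r₁ r₂ : ℝ}
    (hd : IsEuclideanDesignTwoSpheres k X₁ X₂ w r₁ r₂) :
    IsEuclideanDesignTwoSpheres k X₂ X₁ w r₂ r₁ := fun f hf => by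
  rw [add_comm, Finset.union_comm]
  exact hd f hf

theorem IsEuclideanDesignTwoSpheres.fiberMoments
    {X₁ X₂ : Finset (EuclideanSpace ℝ (Fin 22))} {w : EuclideanSpace ℝ (Fin 22) → ℝ}
    {r₁ r₂ : ℝ} (hr₁ : 0 < r₁) (hr₂ : 0 < r₂) (hrne : r₁ ≠ r₂)
    (hX₁ : ∀ x ∈ X₁, ‖x‖ = r₁) (hX₂ : ∀ x ∈ X₂, ‖x‖ = r₂)
    (hw : ∀ x ∈ X₁ ∪ X₂, 0 < w x)
    (hd : IsEuclideanDesignTwoSpheres 6 X₁ X₂ w r₁ r₂) :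
    FiberMoments X₁ X₂ w (fun x y => ⟪x, y⟫ / (‖x‖ * ‖y‖)) r₁ r₂ := by
  have hunit : ∀ x ∈ X₁, ‖‖x‖⁻¹ • x‖ = 1 := fun x hx => by
    rw [norm_smul, norm_inv, norm_norm, inv_mul_cancel₀ (by rw [hX₁ x hx]; exact hr₁.ne')]
  have hpow₁ : ∀ x (k : ℕ), ∑ y ∈ X₁, w y * ⟪‖x‖⁻¹ • x, y⟫ ^ k
      = r₁ ^ k * ∑ y ∈ X₁, w y * (⟪x, y⟫ / (‖x‖ * ‖y‖)) ^ k := fun x k => by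
    rw [Finset.mul_sum]
    refine Finset.sum_congr rfl fun y hy => ?_
    rw [hX₁ y hy, inner_smul_left, mul_left_comm, ← mul_pow]
    congr 2
    simp only [conj_trivial]
    field_simp
  have hpow₂ : ∀ x (k : ℕ), ∑ y ∈ X₂, w y * ⟪‖x‖⁻¹ • x, y⟫ ^ k
      = r₂ ^ k * ∑ y ∈ X₂, w y * (⟪x, y⟫ / (‖x‖ * ‖y‖)) ^ k := fun x k => by
    rw [Finset.mul_sum]
    refine Finset.sum_congr rfl fun y hy => ?_
    rw [hX₂ y hy, inner_smul_left, mul_left_comm, ← mul_pow]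
    congr 2
    simp only [conj_trivial]
    field_simp
  refine ⟨hr₁, hr₂, fun x hx => hw x (Finset.mem_union_left _ hx),
    fun x hx => hw x (Finset.mem_union_right _ hx), fun x hx => ?_, fun x hx k hk => ?_,
    fun x hx k hk => ?_, fun x hx k hk => ?_⟩
  · rw [real_inner_self_eq_norm_mul_norm, div_self]
    rw [hX₁ x hx]
    positivity
  · have h := (hd.zonal_sum_fiber hr₁ hr₂ hrne hX₁ hX₂ (hunit x hx) hk).1
    rw [hpow₁] at h
    apply mul_left_cancel₀ (pow_pos hr₁ k).ne'
    rw [h]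
    ring
  · have h := (hd.zonal_sum_fiber hr₁ hr₂ hrne hX₁ hX₂ (hunit x hx) hk).2
    rw [hpow₂] at h
    apply mul_left_cancel₀ (pow_pos hr₂ k).ne'
    rw [h]
    ring
  · have h := hd.zonal_sum hrne hX₁ hX₂ (hunit x hx) (a := k) (j := 0) (by omega)
    rw [hpow₁, hpow₂] at h
    simpa using h

/-- The zonal harmonic of degree `2` on the unit sphere of `ℝ²²`. -/
noncomputable def zonalTwo (t : ℝ) : ℝ := 12 * (22 * t ^ 2 - 1)

/-- The zonal harmonic of degree `3` on the unit sphere of `ℝ²²`. -/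
noncomputable def zonalThree (t : ℝ) : ℝ := 286 * (8 * t ^ 3 - t)

theorem sum_weight_mul_cubic_sq {α : Type*} (A : Finset α) (w u : α → ℝ) (a b c d : ℝ) :
    ∑ y ∈ A, w y * (a + b * u y + c * u y ^ 2 + d * u y ^ 3) ^ 2
      = a ^ 2 * ∑ y ∈ A, w y * u y ^ 0 + 2 * a * b * ∑ y ∈ A, w y * u y ^ 1
        + (b ^ 2 + 2 * a * c) * ∑ y ∈ A, w y * u y ^ 2
        + (2 * a * d + 2 * b * c) * ∑ y ∈ A, w y * u y ^ 3
        + (c ^ 2 + 2 * b * d) * ∑ y ∈ A, w y * u y ^ 4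
        + 2 * c * d * ∑ y ∈ A, w y * u y ^ 5 + d ^ 2 * ∑ y ∈ A, w y * u y ^ 6 := by
  simp only [Finset.mul_sum, ← Finset.sum_add_distrib]
  exact Finset.sum_congr rfl fun y _ => by ring

namespace FiberMoments

variable {α : Type*} {A B : Finset α} {w : α → ℝ} {t : α → α → ℝ} {r s : ℝ}

/-- The reproducing property of the kernel of the cubic polynomials on the two spheres. -/
theorem sum_kernel_sq (h : FiberMoments A B w t r s) {a b o : ℝ}
    (ho : o * ∑ y ∈ A, w y = 1)
    (ha : a * ((∑ y ∈ A, w y) * r ^ 4 + (∑ y ∈ B, w y) * s ^ 4) = 1)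
    (hb : b * ((∑ y ∈ A, w y) * r ^ 6 + (∑ y ∈ B, w y) * s ^ 6) = 1)
    {x : α} (hx : x ∈ A) :
    ∑ y ∈ A, w y * (o * (1 + 22 * t x y) + a * r ^ 4 * zonalTwo (t x y)
        + b * r ^ 6 * zonalThree (t x y)) ^ 2
      + ∑ y ∈ B, w y * (a * r ^ 2 * s ^ 2 * zonalTwo (t x y)
        + b * r ^ 3 * s ^ 3 * zonalThree (t x y)) ^ 2
      = 23 * o + 252 * (a * r ^ 4) + 2002 * (b * r ^ 6) := by
  have e₁ : ∀ y, o * (1 + 22 * t x y) + a * r ^ 4 * zonalTwo (t x y)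
        + b * r ^ 6 * zonalThree (t x y)
      = (o - 12 * a * r ^ 4) + (22 * o - 286 * b * r ^ 6) * t x y
        + (264 * a * r ^ 4) * t x y ^ 2 + (2288 * b * r ^ 6) * t x y ^ 3 := fun y => by
    unfold zonalTwo zonalThree; ring
  have e₂ : ∀ y, a * r ^ 2 * s ^ 2 * zonalTwo (t x y) + b * r ^ 3 * s ^ 3 * zonalThree (t x y)
      = (-12 * a * r ^ 2 * s ^ 2) + (-286 * b * r ^ 3 * s ^ 3) * t x y
        + (264 * a * r ^ 2 * s ^ 2) * t x y ^ 2 + (2288 * b * r ^ 3 * s ^ 3) * t x y ^ 3 :=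
    fun y => by unfold zonalTwo zonalThree; ring
  simp only [e₁, e₂, sum_weight_mul_cubic_sq]
  have h5 := h.total x hx 5 (by norm_num)
  have h6 := h.total x hx 6 (by norm_num)
  rw [h.same x hx 0 (by norm_num), h.same x hx 1 (by norm_num), h.same x hx 2 (by norm_num),
    h.same x hx 3 (by norm_num), h.same x hx 4 (by norm_num),
    h.cross x hx 0 (by norm_num), h.cross x hx 1 (by norm_num), h.cross x hx 2 (by norm_num),
    h.cross x hx 3 (by norm_num), h.cross x hx 4 (by norm_num)]
  simp only [sphereMoment] at h5 h6 ⊢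
  linear_combination 2 * 264 * 2288 * a * b * r ^ 5 * h5 + 2288 ^ 2 * b ^ 2 * r ^ 6 * h6
    + 23 * o * ho + 252 * a * r ^ 4 * ha + 2002 * b * r ^ 6 * hb

theorem weight_mul_kernel_sq_add (h : FiberMoments A B w t r s) {a b o : ℝ}
    (ho : o * ∑ y ∈ A, w y = 1)
    (ha : a * ((∑ y ∈ A, w y) * r ^ 4 + (∑ y ∈ B, w y) * s ^ 4) = 1)
    (hb : b * ((∑ y ∈ A, w y) * r ^ 6 + (∑ y ∈ B, w y) * s ^ 6) = 1)
    {x : α} (hx : x ∈ A) :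
    w x * (23 * o + 252 * (a * r ^ 4) + 2002 * (b * r ^ 6)) ^ 2
      + (∑ y ∈ A.erase x, w y * (o * (1 + 22 * t x y) + a * r ^ 4 * zonalTwo (t x y)
        + b * r ^ 6 * zonalThree (t x y)) ^ 2
      + ∑ y ∈ B, w y * (a * r ^ 2 * s ^ 2 * zonalTwo (t x y)
        + b * r ^ 3 * s ^ 3 * zonalThree (t x y)) ^ 2)
      = 23 * o + 252 * (a * r ^ 4) + 2002 * (b * r ^ 6) := by
  have hs := h.sum_kernel_sq ho ha hb hx
  have hk : o * (1 + 22 * 1) + a * r ^ 4 * zonalTwo 1 + b * r ^ 6 * zonalThree 1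
      = 23 * o + 252 * (a * r ^ 4) + 2002 * (b * r ^ 6) := by
    unfold zonalTwo zonalThree; ring
  rwa [← Finset.add_sum_erase _ _ hx, h.self x hx, add_assoc, hk] at hs

theorem weight_mul_kernel_le_one (h : FiberMoments A B w t r s) {a b o : ℝ}
    (ho : o * ∑ y ∈ A, w y = 1)
    (ha : a * ((∑ y ∈ A, w y) * r ^ 4 + (∑ y ∈ B, w y) * s ^ 4) = 1)
    (hb : b * ((∑ y ∈ A, w y) * r ^ 6 + (∑ y ∈ B, w y) * s ^ 6) = 1)
    (hk : 0 < 23 * o + 252 * (a * r ^ 4) + 2002 * (b * r ^ 6)) {x : α} (hx : x ∈ A) :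
    w x * (23 * o + 252 * (a * r ^ 4) + 2002 * (b * r ^ 6)) ≤ 1 := by
  have hs := h.weight_mul_kernel_sq_add ho ha hb hx
  set k := 23 * o + 252 * (a * r ^ 4) + 2002 * (b * r ^ 6)
  have hA := Finset.sum_nonneg fun y (hy : y ∈ A.erase x) => mul_nonneg
    (h.weight_pos y (Finset.mem_of_mem_erase hy)).le (sq_nonneg (o * (1 + 22 * t x y)
      + a * r ^ 4 * zonalTwo (t x y) + b * r ^ 6 * zonalThree (t x y)))
  have hB := Finset.sum_nonneg fun y hy => mul_nonneg (h.weight_pos_other y hy).le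
    (sq_nonneg (a * r ^ 2 * s ^ 2 * zonalTwo (t x y) + b * r ^ 3 * s ^ 3 * zonalThree (t x y)))
  refine le_of_mul_le_mul_right ?_ hk
  linarith

theorem kernel_eq_zero (h : FiberMoments A B w t r s) {a b o : ℝ}
    (ho : o * ∑ y ∈ A, w y = 1)
    (ha : a * ((∑ y ∈ A, w y) * r ^ 4 + (∑ y ∈ B, w y) * s ^ 4) = 1)
    (hb : b * ((∑ y ∈ A, w y) * r ^ 6 + (∑ y ∈ B, w y) * s ^ 6) = 1)
    {x : α} (hx : x ∈ A)
    (hk : w x * (23 * o + 252 * (a * r ^ 4) + 2002 * (b * r ^ 6)) = 1) :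
    (∀ y ∈ A, y ≠ x → o * (1 + 22 * t x y) + a * r ^ 4 * zonalTwo (t x y)
        + b * r ^ 6 * zonalThree (t x y) = 0) ∧
    (∀ y ∈ B, a * r ^ 2 * s ^ 2 * zonalTwo (t x y)
        + b * r ^ 3 * s ^ 3 * zonalThree (t x y) = 0) := by
  have hs := h.weight_mul_kernel_sq_add ho ha hb hx
  rw [pow_two (_ + _ + _ : ℝ), ← mul_assoc, hk, one_mul, add_eq_left] at hs
  have hA : ∀ y ∈ A.erase x, 0 < w y := fun y hy => h.weight_pos y (Finset.mem_of_mem_erase hy)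
  have hA' : ∀ y ∈ A.erase x, 0 ≤ w y * (o * (1 + 22 * t x y) + a * r ^ 4 * zonalTwo (t x y)
        + b * r ^ 6 * zonalThree (t x y)) ^ 2 := fun y hy =>
    mul_nonneg (hA y hy).le (sq_nonneg _)
  have hB' : ∀ y ∈ B, 0 ≤ w y * (a * r ^ 2 * s ^ 2 * zonalTwo (t x y)
        + b * r ^ 3 * s ^ 3 * zonalThree (t x y)) ^ 2 := fun y hy =>
    mul_nonneg (h.weight_pos_other y hy).le (sq_nonneg _)
  rw [add_eq_zero_iff_of_nonneg (Finset.sum_nonneg hA') (Finset.sum_nonneg hB'),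
    Finset.sum_eq_zero_iff_of_nonneg hA', Finset.sum_eq_zero_iff_of_nonneg hB'] at hs
  constructor
  · intro y hy hyx
    have hy' := Finset.mem_erase.mpr ⟨hyx, hy⟩
    exact pow_eq_zero_iff two_ne_zero |>.mp <|
      (mul_eq_zero.mp (hs.1 y hy')).resolve_left (hA y hy').ne'
  · intro y hy
    exact pow_eq_zero_iff two_ne_zero |>.mp <|
      (mul_eq_zero.mp (hs.2 y hy)).resolve_left (h.weight_pos_other y hy).ne'

/-- Tightness: a two-fiber Euclidean `6`-design of size `2300` diagonalizes the kernel. -/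
theorem exists_parameters (h : FiberMoments A B w t r s) (h' : FiberMoments B A w t s r)
    (hA : A.Nonempty) (hB : B.Nonempty) (hcard : A.card + B.card = 2300) :
    ∃ p q c : ℝ, 0 < p ∧ p < 1 ∧ 0 < c ∧ 252 * p + 2002 * q = B.card - 23 ∧
      c ^ 2 * (p * (1 - p)) = q * (1 - q) ∧
      (∀ x ∈ A, ∀ y ∈ B, zonalTwo (t x y) + c * zonalThree (t x y) = 0) ∧
      (∀ x ∈ B, ∀ y ∈ A, zonalTwo (t x y) + c * zonalThree (t x y) = 0) ∧
      (∀ x ∈ B, ∀ y ∈ B, y ≠ x →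
        1 + 22 * t x y + p * zonalTwo (t x y) + q * zonalThree (t x y) = 0) ∧
      (∃ m : ℝ, 0 < m ∧ ∀ x ∈ A, w x = m) ∧ (∃ m : ℝ, 0 < m ∧ ∀ x ∈ B, w x = m) := by
  have hr := h.r_pos
  have hs := h.s_pos
  have hWA : 0 < ∑ y ∈ A, w y := Finset.sum_pos h.weight_pos hA
  have hWB : 0 < ∑ y ∈ B, w y := Finset.sum_pos h'.weight_pos hB
  have kA := fun x hx => h.weight_mul_kernel_le_one (x := x) (o := (∑ y ∈ A, w y)⁻¹)
    (a := ((∑ y ∈ A, w y) * r ^ 4 + (∑ y ∈ B, w y) * s ^ 4)⁻¹)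
    (b := ((∑ y ∈ A, w y) * r ^ 6 + (∑ y ∈ B, w y) * s ^ 6)⁻¹)
    (inv_mul_cancel₀ hWA.ne') (inv_mul_cancel₀ (by positivity)) (inv_mul_cancel₀ (by positivity))
    (by positivity) hx
  have kB := fun x hx => h'.weight_mul_kernel_le_one (x := x) (o := (∑ y ∈ B, w y)⁻¹)
    (a := ((∑ y ∈ A, w y) * r ^ 4 + (∑ y ∈ B, w y) * s ^ 4)⁻¹)
    (b := ((∑ y ∈ A, w y) * r ^ 6 + (∑ y ∈ B, w y) * s ^ 6)⁻¹)
    (inv_mul_cancel₀ hWB.ne') (by rw [add_comm (_ * s ^ 4)]; exact inv_mul_cancel₀ (by positivity))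
    (by rw [add_comm (_ * s ^ 6)]; exact inv_mul_cancel₀ (by positivity))
    (by positivity) hx
  have zA := fun x hx => h.kernel_eq_zero (x := x) (o := (∑ y ∈ A, w y)⁻¹)
    (a := ((∑ y ∈ A, w y) * r ^ 4 + (∑ y ∈ B, w y) * s ^ 4)⁻¹)
    (b := ((∑ y ∈ A, w y) * r ^ 6 + (∑ y ∈ B, w y) * s ^ 6)⁻¹)
    (inv_mul_cancel₀ hWA.ne') (inv_mul_cancel₀ (by positivity)) (inv_mul_cancel₀ (by positivity))
    hx
  have zB := fun x hx => h'.kernel_eq_zero (x := x) (o := (∑ y ∈ B, w y)⁻¹)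
    (a := ((∑ y ∈ A, w y) * r ^ 4 + (∑ y ∈ B, w y) * s ^ 4)⁻¹)
    (b := ((∑ y ∈ A, w y) * r ^ 6 + (∑ y ∈ B, w y) * s ^ 6)⁻¹)
    (inv_mul_cancel₀ hWB.ne') (by rw [add_comm (_ * s ^ 4)]; exact inv_mul_cancel₀ (by positivity))
    (by rw [add_comm (_ * s ^ 6)]; exact inv_mul_cancel₀ (by positivity)) hx
  obtain ⟨U, hU⟩ : ∃ U, U = ∑ y ∈ A, w y := ⟨_, rfl⟩
  obtain ⟨V, hV⟩ : ∃ V, V = ∑ y ∈ B, w y := ⟨_, rfl⟩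
  rw [← hU] at hWA
  rw [← hV] at hWB
  rw [← hU, ← hV] at kA kB zA zB
  set a := (U * r ^ 4 + V * s ^ 4)⁻¹ with ha
  set b := (U * r ^ 6 + V * s ^ 6)⁻¹ with hb
  have ha0 : 0 < a := by positivity
  have hb0 : 0 < b := by positivity
  have ha1 : a * (U * r ^ 4 + V * s ^ 4) = 1 := inv_mul_cancel₀ (by positivity)
  have hb1 : b * (U * r ^ 6 + V * s ^ 6) = 1 := inv_mul_cancel₀ (by positivity)
  have hU1 : U⁻¹ * U = 1 := inv_mul_cancel₀ hWA.ne'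
  have hV1 : V⁻¹ * V = 1 := inv_mul_cancel₀ hWB.ne'
  set K := 23 * U⁻¹ + 252 * (a * r ^ 4) + 2002 * (b * r ^ 6) with hK
  set L := 23 * V⁻¹ + 252 * (a * s ^ 4) + 2002 * (b * s ^ 6) with hL
  have hK0 : 0 < K := by positivity
  have hL0 : 0 < L := by positivity
  have htrace : U * K + V * L = (A.card : ℝ) + B.card := by
    have : (A.card : ℝ) + B.card = 2300 := by exact_mod_cast hcard
    rw [this, hK, hL]
    linear_combination 23 * hU1 + 23 * hV1 + 252 * ha1 + 2002 * hb1
  have hUK : U * K ≤ A.card := by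
    rw [hU, Finset.sum_mul]
    simpa using Finset.sum_le_sum kA
  have hVL : V * L ≤ B.card := by
    rw [hV, Finset.sum_mul]
    simpa using Finset.sum_le_sum kB
  have eA : ∀ x ∈ A, w x * K = 1 := by
    refine (Finset.sum_eq_sum_iff_of_le kA).mp ?_
    rw [← Finset.sum_mul, ← hU]
    simp only [Finset.sum_const, nsmul_eq_mul, mul_one]
    linarith
  have eB : ∀ x ∈ B, w x * L = 1 := by
    refine (Finset.sum_eq_sum_iff_of_le kB).mp ?_
    rw [← Finset.sum_mul, ← hV]
    simp only [Finset.sum_const, nsmul_eq_mul, mul_one]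
    linarith
  have hVLe : V * L = B.card := by linarith
  refine ⟨V * s ^ 4 * a, V * s ^ 6 * b, b * r * s / a, by positivity, ?_, by positivity, ?_, ?_,
    fun x hx y hy => ?_, fun x hx y hy => ?_, fun x hx y hy hyx => ?_, ⟨K⁻¹, by positivity,
    fun x hx => eq_inv_of_mul_eq_one_left (eA x hx)⟩, ⟨L⁻¹, by positivity,
    fun x hx => eq_inv_of_mul_eq_one_left (eB x hx)⟩⟩
  · have : 0 < a * (U * r ^ 4) := by positivity
    linarith
  · rw [← hVLe, hL]
    linear_combination -23 * hV1
  · have h1 : 1 - V * s ^ 4 * a = U * r ^ 4 * a := by linear_combination -ha1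
    have h2 : 1 - V * s ^ 6 * b = U * r ^ 6 * b := by linear_combination -hb1
    rw [h1, h2]
    field_simp
  · have hz := (zA x hx (eA x hx)).2 y hy
    have hne : a * r ^ 2 * s ^ 2 ≠ 0 := by positivity
    apply mul_left_cancel₀ hne
    rw [mul_zero, ← hz]
    field_simp
  · have hz := (zB x hx (eB x hx)).2 y hy
    have hne : a * r ^ 2 * s ^ 2 ≠ 0 := by positivity
    apply mul_left_cancel₀ hne
    rw [mul_zero, ← hz]
    field_simp
  · have hz := (zB x hx (eB x hx)).1 y hy hyx
    linear_combination V * hz - (1 + 22 * t x y) * hV1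

end FiberMoments

/-- The Christoffel number of a node of a quasi-orthogonal cubic. -/
theorem card_filter_mul_christoffel {α : Type*} {S : Finset α} {u : α → ℝ} {c τ : ℝ}
    (h1 : ∑ y ∈ S, u y = 0) (h2 : ∑ y ∈ S, u y ^ 2 = S.card / 22)
    (hz : ∀ y ∈ S, zonalTwo (u y) + c * zonalThree (u y) = 0)
    (hτ : zonalTwo τ + c * zonalThree τ = 0) :
    ((S.filter fun y => u y = τ).card : ℝ) * (4 * (22 * τ ^ 2) ^ 2 - 22 * τ ^ 2 + 11)
      = 7 * S.card := by
  have hh : ∀ y ∈ S, 11 + 154 * τ * u y + 1936 * τ ^ 2 * u y ^ 2 - 88 * u y ^ 2 - 88 * τ ^ 2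
      = if u y = τ then 4 * (22 * τ ^ 2) ^ 2 - 22 * τ ^ 2 + 11 else 0 := fun y hy => by
    split_ifs with hy'
    · rw [hy']; ring
    · apply mul_left_cancel₀ (sub_ne_zero.mpr hy')
      have := hz y hy
      simp only [zonalTwo, zonalThree] at this hτ
      linear_combination (11 / 12) * (8 * u y ^ 3 - u y) * hτ - (11 / 12) * (8 * τ ^ 3 - τ) * this
  have hs := Finset.sum_congr rfl hh
  rw [← Finset.sum_filter, Finset.sum_const, nsmul_eq_mul] at hs
  rw [← hs]
  simp only [Finset.sum_sub_distrib, Finset.sum_add_distrib, ← Finset.mul_sum, Finset.sum_const,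
    nsmul_eq_mul, h1, h2]
  ring

theorem exists_small_node {c : ℝ} (hc : 50 ≤ 143 * c) :
    ∃ τ : ℝ, zonalTwo τ + c * zonalThree τ = 0 ∧ 22 * τ ^ 2 ≤ 1 / 4 := by
  have hcont : ContinuousOn (fun τ : ℝ => zonalTwo τ + c * zonalThree τ)
      (Set.Icc (-(21 / 200)) 0) := by
    unfold zonalTwo zonalThree
    fun_prop
  have hivt := intermediate_value_Icc' (by norm_num) hcont
  obtain ⟨τ, ⟨h1, h2⟩, h⟩ := hivt (show (0 : ℝ) ∈ _ by
    constructor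
    · norm_num [zonalTwo, zonalThree]
    · simp only [zonalTwo, zonalThree]
      linarith)
  exact ⟨τ, h, by nlinarith⟩

namespace FiberMoments

variable {α : Type*} {A B : Finset α} {w : α → ℝ} {t : α → α → ℝ} {r s : ℝ}

theorem sum_same (h : FiberMoments A B w t r s) {m : ℝ} (hm : 0 < m) (hw : ∀ x ∈ A, w x = m)
    {x : α} (hx : x ∈ A) {k : ℕ} (hk : k ≤ 4) :
    ∑ y ∈ A, t x y ^ k = A.card * sphereMoment k := by
  have hs := h.same x hx k hk
  rw [Finset.sum_congr rfl fun y hy => by rw [hw y hy], ← Finset.mul_sum,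
    Finset.sum_congr rfl hw, Finset.sum_const, nsmul_eq_mul] at hs
  apply mul_left_cancel₀ hm.ne'
  rw [hs]
  ring

theorem sum_cross (h : FiberMoments A B w t r s) {m : ℝ} (hm : 0 < m) (hw : ∀ x ∈ B, w x = m)
    {x : α} (hx : x ∈ A) {k : ℕ} (hk : k ≤ 4) :
    ∑ y ∈ B, t x y ^ k = B.card * sphereMoment k := by
  have hs := h.cross x hx k hk
  rw [Finset.sum_congr rfl fun y hy => by rw [hw y hy], ← Finset.mul_sum,
    Finset.sum_congr rfl hw, Finset.sum_const, nsmul_eq_mul] at hs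
  apply mul_left_cancel₀ hm.ne'
  rw [hs]
  ring

theorem inner_cubic (h : FiberMoments A B w t r s) (h' : FiberMoments B A w t s r)
    (hA : A.card = 275) (hB : B.card = 2025) {x : α} (hx : x ∈ B) :
    (∀ y ∈ B, y ≠ x → (22 * t x y - 7) * (44 * t x y + 1) * (11 * t x y + 4) = 0) ∧
      ∑ y ∈ B, t x y = 0 ∧ ∑ y ∈ B, t x y ^ 2 = 2025 / 22 := by
  have hAne : A.Nonempty := Finset.card_pos.mp (by omega)
  obtain ⟨z, hz⟩ := hAne
  obtain ⟨p, q, c, hp0, hp1, hc0, hpq, hc, hAB, hBA, hBB, ⟨mA, hmA, hwA⟩, ⟨mB, hmB, hwB⟩⟩ :=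
    h.exists_parameters h' ⟨z, hz⟩ ⟨x, hx⟩ (by omega)
  have hq : q = 1 - 18 * p / 143 := by
    rw [hB] at hpq
    push_cast at hpq
    linarith
  have hcp : c ^ 2 * (1 - p) = 18 / 143 * (1 - 18 * p / 143) := by
    apply mul_left_cancel₀ hp0.ne'
    rw [hq] at hc
    linear_combination hc
  have hc50 : 50 ≤ 143 * c := by
    by_contra! hlt
    have h1 : (143 * c) ^ 2 < 2500 := by nlinarith
    nlinarith
  obtain ⟨τ, hτ, hv⟩ := exists_small_node hc50
  have e₁ := card_filter_mul_christoffel (u := t x)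
    (by simpa [sphereMoment] using h'.sum_cross hmA hwA hx (k := 1) (by norm_num))
    (by simpa [sphereMoment, div_eq_mul_inv] using h'.sum_cross hmA hwA hx (k := 2) (by norm_num))
    (hBA x hx) hτ
  have e₂ := card_filter_mul_christoffel (u := t z)
    (by simpa [sphereMoment] using h.sum_cross hmB hwB hz (k := 1) (by norm_num))
    (by simpa [sphereMoment, div_eq_mul_inv] using h.sum_cross hmB hwB hz (k := 2) (by norm_num))
    (hAB z hz) hτ
  rw [hA] at e₁
  rw [hB] at e₂
  obtain ⟨M, hM⟩ : ∃ M, M = (A.filter fun y => t x y = τ).card := ⟨_, rfl⟩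
  obtain ⟨N, hN⟩ : ∃ N, N = (B.filter fun y => t z y = τ).card := ⟨_, rfl⟩
  rw [← hM] at e₁
  rw [← hN] at e₂
  push_cast at e₁ e₂
  set v := 22 * τ ^ 2 with hvdef
  have hv0 : 0 ≤ v := by positivity
  have hD : 0 < 4 * v ^ 2 - v + 11 := by nlinarith
  have hMN : 81 * M = 11 * N := by
    have : (81 * M : ℝ) = 11 * N := by
      apply mul_right_cancel₀ hD.ne'
      linear_combination 81 * e₁ - 11 * e₂
    exact_mod_cast this
  have hMlow : 174 < M := by
    have : (174 : ℝ) < M := by nlinarith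
    exact_mod_cast this
  have hMup : M < 177 := by
    have : (M : ℝ) < 177 := by nlinarith [sq_nonneg (8 * v - 1)]
    exact_mod_cast this
  have hM176 : M = 176 := by omega
  have hv8 : v = 1 / 8 := by
    rw [hM176] at e₁
    have : (8 * v - 1) ^ 2 = 0 := by push_cast at e₁; linear_combination e₁ / 11
    have := pow_eq_zero_iff two_ne_zero |>.mp this
    linarith
  have hτ2 : τ ^ 2 = 1 / 176 := by linarith
  have hcτ : c * τ = -1 / 26 := by
    simp only [zonalTwo, zonalThree] at hτ
    linear_combination (-1 / 273) * hτ + (264 / 273 + 2288 * c * τ / 273) * hτ2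
  have hc2 : c ^ 2 = 44 / 169 := by
    have : c ^ 2 * τ ^ 2 = 1 / 676 := by
      rw [← mul_pow, hcτ]; norm_num
    rw [hτ2] at this
    linarith
  have hp : p = 11 / 20 := by
    rw [hc2] at hcp
    linarith
  refine ⟨fun y hy hyx => ?_, ?_, ?_⟩
  · have hzero := hBB x hx y hy hyx
    rw [hq, hp] at hzero
    simp only [zonalTwo, zonalThree] at hzero
    linear_combination 5 * hzero
  · simpa [sphereMoment] using h'.sum_same hmB hwB hx (k := 1) (by norm_num)
  · rw [h'.sum_same hmB hwB hx (by norm_num), hB]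
    norm_num [sphereMoment]

end FiberMoments

/-- Counting a value of `u` with a quadratic vanishing at the other values. -/
theorem card_filter_eq_of_quadratic {α : Type*} {S : Finset α} {u : α → ℝ} {x : α} (hx : x ∈ S)
    (hself : u x = 1) (h1 : ∑ y ∈ S, u y = 0) (h2 : ∑ y ∈ S, u y ^ 2 = S.card / 22)
    {τ a b c : ℝ} (hτ : τ ≠ 1)
    (hq : ∀ y ∈ S, y ≠ x → u y ≠ τ → a * u y ^ 2 + b * u y + c = 0) :
    ((S.filter fun y => u y = τ).card : ℝ) * (a * τ ^ 2 + b * τ + c)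
      = S.card * (a / 22 + c) - (a + b + c) := by
  have hh : ∀ y ∈ S, a * u y ^ 2 + b * u y + c
      = (if u y = τ then a * τ ^ 2 + b * τ + c else 0) + if y = x then a + b + c else 0 := by
    intro y hy
    by_cases hyx : y = x
    · rw [hyx, hself, if_neg hτ.symm, if_pos rfl]
      ring
    · by_cases hyτ : u y = τ
      · rw [if_pos hyτ, if_neg hyx, hyτ, add_zero]
      · rw [if_neg hyτ, if_neg hyx, hq y hy hyx hyτ, add_zero]
  have hs := Finset.sum_congr rfl hh
  simp only [Finset.sum_add_distrib, ← Finset.mul_sum,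
    Finset.sum_ite_eq' S x, if_pos hx, Finset.sum_const, nsmul_eq_mul, h1, h2] at hs
  rw [← Finset.sum_filter, Finset.sum_const, nsmul_eq_mul] at hs
  linear_combination -hs

/-- intersection numbers within `X₂`: each point of `X₂` has inner product
`7r₂²/22` with exactly 462 points, `-r₂²/44` with exactly 1232 points, and `-4r₂²/11`
with exactly 330 points of `X₂`. -/
theorem statement8
    {X₁ X₂ : Finset (EuclideanSpace ℝ (Fin 22))} {w : EuclideanSpace ℝ (Fin 22) → ℝ}
    {r₁ r₂ : ℝ} (hr₁ : 0 < r₁) (hr₂ : 0 < r₂) (hrne : r₁ ≠ r₂)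
    (hX₁ : ∀ x ∈ X₁, ‖x‖ = r₁) (hX₂ : ∀ x ∈ X₂, ‖x‖ = r₂)
    (hw : ∀ x ∈ X₁ ∪ X₂, 0 < w x)
    (hcard : (X₁ ∪ X₂).card = 2300) (hcard₁ : X₁.card = 275)
    (hdesign : IsEuclideanDesignTwoSpheres 6 X₁ X₂ w r₁ r₂) :
    ∀ x ∈ X₂,
      (X₂.filter fun y => ⟪x, y⟫ = 7 * r₂ ^ 2 / 22).card = 462 ∧
      (X₂.filter fun y => ⟪x, y⟫ = -(r₂ ^ 2 / 44)).card = 1232 ∧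
      (X₂.filter fun y => ⟪x, y⟫ = -(4 * r₂ ^ 2 / 11)).card = 330 := by
  have hd : Disjoint X₁ X₂ := disjoint_of_norm_eq hrne hX₁ hX₂
  have hcard₂ : X₂.card = 2025 := by
    rw [Finset.card_union_of_disjoint hd] at hcard
    omega
  have h := hdesign.fiberMoments hr₁ hr₂ hrne hX₁ hX₂ hw
  have h' := hdesign.symm.fiberMoments hr₂ hr₁ hrne.symm hX₂ hX₁
    (by rwa [Finset.union_comm] at hw)
  intro x hx
  obtain ⟨hcubic, h1, h2⟩ := h.inner_cubic h' hcard₁ hcard₂ hx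
  have hfilter : ∀ d τ : ℝ, d = τ * r₂ ^ 2 →
      (X₂.filter fun y => ⟪x, y⟫ = d) = X₂.filter fun y => ⟪x, y⟫ / (‖x‖ * ‖y‖) = τ := by
    rintro d τ rfl
    refine Finset.filter_congr fun y hy => ?_
    rw [hX₂ x hx, hX₂ y hy, ← pow_two, div_eq_iff (by positivity)]
  have hcount := fun τ a b c hτ hq => card_filter_eq_of_quadratic (τ := τ) (a := a) (b := b)
    (c := c) hx (h'.self x hx) h1 (by rw [h2, hcard₂]; norm_num) hτ hq
  rw [hcard₂] at hcount
  refine ⟨?_, ?_, ?_⟩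
  · rw [hfilter _ (7 / 22) (by ring)]
    have := hcount (7 / 22) 484 187 4 (by norm_num) fun y hy hyx hyτ => by
      have hne : 22 * (⟪x, y⟫ / (‖x‖ * ‖y‖)) - 7 ≠ 0 := fun h0 => hyτ (by linarith)
      apply mul_left_cancel₀ hne
      linear_combination hcubic y hy hyx
    rify
    linarith
  · rw [hfilter _ (-1 / 44) (by ring)]
    have := hcount (-1 / 44) 242 11 (-28) (by norm_num) fun y hy hyx hyτ => by
      have hne : 44 * (⟪x, y⟫ / (‖x‖ * ‖y‖)) + 1 ≠ 0 := fun h0 => hyτ (by linarith)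
      apply mul_left_cancel₀ hne
      linear_combination hcubic y hy hyx
    rify
    linarith
  · rw [hfilter _ (-4 / 11) (by ring)]
    have := hcount (-4 / 11) 968 (-286) (-7) (by norm_num) fun y hy hyx hyτ => by
      have hne : 11 * (⟪x, y⟫ / (‖x‖ * ‖y‖)) + 4 ≠ 0 := fun h0 => hyτ (by linarith)
      apply mul_left_cancel₀ hne
      linear_combination hcubic y hy hyx
    rify
    linarith
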